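/- In the iidpnmrv setup with E^*[|X₁|] < ∞, let a ∈ [E_*[X₁], E^*[X₁]] and let ε > 0 be such that [E_*[X₁], E^*[X₁]] is not contained in [a−ε, a+ε]. Then the outer probability of the event {ω : |Sₙ(ω)/n − a| > ε} tends to 1 as n → ∞; that is, inf{P(B) : B P-measurable, {ω : |Sₙ(ω)/n − a| > ε} ⊆ B} → 1. -/

import Mathlib

open MeasureTheory Filter Topology

/-- `flow` is a maximal measurable minorant of `f` with respect to the measure `P`. -/
def IsMeasMinorant {Ω : Type*} [MeasurableSpace Ω] (P : Measure Ω) (f flow : Ω → ℝ) : Prop :=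
  Measurable flow ∧ (∀ ω, flow ω ≤ f ω) ∧
    ∀ g : Ω → ℝ, Measurable g → (∀ ω, g ω ≤ f ω) → ∀ᵐ ω ∂P, g ω ≤ flow ω

/-- `fup` is a minimal measurable majorant of `f` with respect to the measure `P`. -/
def IsMeasMajorant {Ω : Type*} [MeasurableSpace Ω] (P : Measure Ω) (f fup : Ω → ℝ) : Prop :=
  Measurable fup ∧ (∀ ω, f ω ≤ fup ω) ∧
    ∀ h : Ω → ℝ, Measurable h → (∀ ω, f ω ≤ h ω) → ∀ᵐ ω ∂P, fup ω ≤ h ω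

/-- A set of full outer measure, possibly nonmeasurable, carries a probability measure on its trace
σ-algebra whose image under the inclusion is the original measure. -/
lemma exists_isProbabilityMeasure_map_subtype_val {α : Type*} [MeasurableSpace α] (μ : Measure α)
    [IsProbabilityMeasure μ] {A : Set α} (hA : μ A = 1) :
    ∃ ν : Measure A, IsProbabilityMeasure ν ∧ ν.map Subtype.val = μ := by
  have hcar : (inferInstance : MeasurableSpace A) ≤
      (OuterMeasure.comap Subtype.val μ.toOuterMeasure).caratheodory := by
    rintro _ ⟨E, hE, rfl⟩
    rw [OuterMeasure.isCaratheodory_iff_le]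
    intro t
    have h₁ : ((↑) '' (t ∩ (↑) ⁻¹' E) : Set α) = (↑) '' t ∩ E := Set.image_inter_preimage _ _ _
    have h₂ : ((↑) '' (t \ (↑) ⁻¹' E) : Set α) = (↑) '' t \ E := by
      ext x; simp only [Set.mem_image, Set.mem_sdiff, Set.mem_preimage]; grind
    simp only [OuterMeasure.comap_apply, h₁, h₂, Measure.coe_toOuterMeasure]
    exact (measure_inter_add_sdiff _ hE).le
  have hmap : ((OuterMeasure.comap Subtype.val μ.toOuterMeasure).toMeasure hcar).map
      Subtype.val = μ := by
    ext E hE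
    rw [Measure.map_apply measurable_subtype_coe hE,
      toMeasure_apply _ _ (measurable_subtype_coe hE), OuterMeasure.comap_apply,
      Subtype.image_preimage_coe, Measure.coe_toOuterMeasure,
      ← Measure.measure_toMeasurable_inter hE (measure_ne_top μ A)]
    have hfull : toMeasurable μ A =ᵐ[μ] Set.univ := by
      rw [ae_eq_univ, prob_compl_eq_zero_iff (measurableSet_toMeasurable μ A),
        measure_toMeasurable, hA]
    simpa using measure_congr (hfull.inter (ae_eq_refl E))
  refine ⟨_, ⟨?_⟩, hmap⟩
  rw [← Set.preimage_univ (f := Subtype.val),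
    ← Measure.map_apply measurable_subtype_coe MeasurableSet.univ, hmap, measure_univ]

/-- Powers of a set of full outer measure have full outer measure for the product measure. -/
lemma infinitePi_le_of_inter_univ_pi_subset {ι α : Type*} [MeasurableSpace α] (μ : Measure α)
    [IsProbabilityMeasure μ] {A : Set α} (hA : μ A = 1) {C D : Set (ι → α)} (hC : MeasurableSet C)
    (hCD : C ∩ Set.univ.pi (fun _ => A) ⊆ D) :
    Measure.infinitePi (fun _ => μ) C ≤ Measure.infinitePi (fun _ => μ) D := by
  obtain ⟨ν, hν, hmap⟩ := exists_isProbabilityMeasure_map_subtype_val μ hA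
  have hpi : (Measure.infinitePi (fun _ : ι => ν)).map (fun ω i => (ω i : α)) =
      Measure.infinitePi (fun _ => μ) := by
    rw [Measure.infinitePi_map_pi (fun _ : ι => ν) (fun _ => measurable_subtype_coe)]
    simp_rw [hmap]
  have hmeas : Measurable (fun (ω : ι → A) i => (ω i : α)) := by fun_prop
  rw [← measure_toMeasurable D, ← hpi, Measure.map_apply hmeas hC,
    Measure.map_apply hmeas (measurableSet_toMeasurable _ D)]
  exact measure_mono fun ω hω =>
    subset_toMeasurable _ D (hCD ⟨hω, fun i _ => (ω i).2⟩)

/-- The weak law of large numbers for the coordinates of an infinite product space. -/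
lemma tendsto_infinitePi_le_abs_average_sub {α : Type*} [MeasurableSpace α] (μ : Measure α)
    [IsProbabilityMeasure μ] {f : α → ℝ} (hf : Measurable f) (hint : Integrable f μ)
    {γ : ℝ} (hγ : 0 < γ) :
    Tendsto (fun n : ℕ => Measure.infinitePi (fun _ : ℕ => μ)
      {ω | γ ≤ |(∑ i ∈ Finset.range n, f (ω i)) / n - ∫ x, f x ∂μ|}) atTop (𝓝 0) := by
  have hmp := fun i : ℕ => measurePreserving_eval_infinitePi (fun _ : ℕ => μ) i
  have hindep : ProbabilityTheory.iIndepFun (fun (i : ℕ) (ω : ℕ → α) => f (ω i))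
      (Measure.infinitePi (fun _ => μ)) :=
    ProbabilityTheory.iIndepFun_infinitePi (fun _ => hf)
  have hlaw := ProbabilityTheory.strong_law_ae_real
    (μ := Measure.infinitePi (fun _ : ℕ => μ)) (fun i ω => f (ω i))
    ((hmp 0).integrable_comp_of_integrable hint) (fun i j hij => hindep.indepFun hij)
    (fun i => ⟨(hf.comp (hmp i).measurable).aemeasurable,
      (hf.comp (hmp 0).measurable).aemeasurable, by
      have h (i : ℕ) : (Measure.infinitePi (fun _ : ℕ => μ)).map (fun ω => f (ω i)) = μ.map f := by
        conv_rhs => rw [← (hmp i).map_eq, Measure.map_map hf (hmp i).measurable]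
        rfl
      rw [h, h]⟩)
  have hmean : ∫ ω, f (ω 0) ∂Measure.infinitePi (fun _ : ℕ => μ) = ∫ x, f x ∂μ := by
    conv_rhs => rw [← (hmp 0).map_eq, integral_map (hmp 0).measurable.aemeasurable
      hf.aestronglyMeasurable]
  simp only [hmean] at hlaw
  have := tendstoInMeasure_of_tendsto_ae
    (fun n => Measurable.aestronglyMeasurable (by fun_prop)) hlaw
  simpa only [Real.dist_eq] using tendstoInMeasure_iff_dist.1 this γ hγ

lemma IsMeasMajorant.measure_sub_lt_eq_one {α : Type*} [MeasurableSpace α] {μ : Measure α}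
    [IsProbabilityMeasure μ] {f fup : α → ℝ} (h : IsMeasMajorant μ f fup) {δ : ℝ} (hδ : 0 < δ) :
    μ {x | fup x - δ < f x} = 1 := by
  classical
  rw [← measure_toMeasurable,
    ← prob_compl_eq_zero_iff (measurableSet_toMeasurable _ _)]
  have hle := h.2.2
    (fun x => if x ∈ toMeasurable μ {x | fup x - δ < f x} then fup x else fup x - δ)
    (Measurable.ite (measurableSet_toMeasurable _ _) h.1 (h.1.sub_const δ)) (fun x => by
      split_ifs with hx
      · exact h.2.1 x
      · exact not_lt.1 fun hlt => hx (subset_toMeasurable _ _ hlt))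
  refine mem_ae_iff.1 (mem_of_superset hle fun x hx => ?_)
  by_contra hmem
  simp only [Set.mem_ofPred_eq, if_neg hmem] at hx
  linarith

lemma IsMeasMinorant.neg {α : Type*} [MeasurableSpace α] {μ : Measure α} {f flow : α → ℝ}
    (h : IsMeasMinorant μ f flow) : IsMeasMajorant μ (fun x => -f x) (fun x => -flow x) := by
  refine ⟨h.1.neg, fun x => neg_le_neg (h.2.1 x), fun g hg hle => ?_⟩
  filter_upwards [h.2.2 (fun x => -g x) hg.neg fun x => neg_le.1 (hle x)] with x hx
  exact neg_le.1 hx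

lemma IsMeasMajorant.integrable {α : Type*} [MeasurableSpace α] {μ : Measure α} {f fup g : α → ℝ}
    (h : IsMeasMajorant μ f fup) (hg : Measurable g) (hfg : ∀ x, |f x| ≤ g x)
    (hint : Integrable g μ) : Integrable fup μ := by
  refine hint.mono' h.1.aestronglyMeasurable ?_
  filter_upwards [h.2.2 g hg fun x => (le_abs_self _).trans (hfg x)] with x hx
  rw [Real.norm_eq_abs]
  exact abs_le.2 ⟨(neg_le.1 ((neg_le_abs _).trans (hfg x))).trans (h.2.1 x), hx⟩

/-- If `c` is below the mean of the minimal measurable majorant, then the outer probability that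
the empirical mean exceeds `c` tends to `1`. -/
lemma IsMeasMajorant.tendsto_infinitePi_lt_average {α : Type*} [MeasurableSpace α] {μ : Measure α}
    [IsProbabilityMeasure μ] {f fup : α → ℝ} (h : IsMeasMajorant μ f fup)
    (hint : Integrable fup μ) {c : ℝ} (hc : c < ∫ x, fup x ∂μ) :
    Tendsto (fun n : ℕ => Measure.infinitePi (fun _ : ℕ => μ)
      {ω | c < (∑ i ∈ Finset.range n, f (ω i)) / n}) atTop (𝓝 1) := by
  obtain ⟨δ, hδ, hδc⟩ : ∃ δ > 0, c + 2 * δ = ∫ x, fup x ∂μ :=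
    ⟨((∫ x, fup x ∂μ) - c) / 2, by linarith, by ring⟩
  have hlim := ENNReal.Tendsto.sub tendsto_const_nhds
    (tendsto_infinitePi_le_abs_average_sub μ h.1 hint hδ) (Or.inl ENNReal.one_ne_top)
  rw [tsub_zero] at hlim
  refine tendsto_of_tendsto_of_tendsto_of_le_of_le' hlim tendsto_const_nhds ?_
    (.of_forall fun n => prob_le_one)
  filter_upwards [eventually_gt_atTop 0] with n hn
  have hmeas : Measurable fun ω : ℕ → α =>
      |(∑ i ∈ Finset.range n, fup (ω i)) / n - ∫ x, fup x ∂μ| := by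
    have := h.1
    fun_prop
  have hset := measurableSet_le (measurable_const (a := δ)) hmeas
  rw [← prob_compl_eq_one_sub hset]
  refine infinitePi_le_of_inter_univ_pi_subset μ (h.measure_sub_lt_eq_one hδ) hset.compl ?_
  rintro ω ⟨hω, hA⟩
  simp only [Set.mem_compl_iff, Set.mem_ofPred_eq, not_le] at hω
  have hn' : (0 : ℝ) < n := by exact_mod_cast hn
  have hsum : ∑ i ∈ Finset.range n, (fup (ω i) - δ) ≤ ∑ i ∈ Finset.range n, f (ω i) :=
    Finset.sum_le_sum fun i _ => (hA i trivial).le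
  rw [Finset.sum_sub_distrib, Finset.sum_const, Finset.card_range, nsmul_eq_mul] at hsum
  have hdiv := div_le_div_of_nonneg_right hsum hn'.le
  rw [sub_div, mul_div_cancel_left₀ _ hn'.ne'] at hdiv
  have := (abs_lt.1 hω).1
  simp only [Set.mem_ofPred_eq]
  linarith

/-- In the iidpnmrv setup with integrable minimal measurable majorant of `|Ψ|`, if `a ∈ [E_*[X₁], E^*[X₁]]` and `ε > 0` is small enough that `[E_*[X₁], E^*[X₁]] ⊄ [a-ε, a+ε]`, then the outer probability of `{|Sₙ/n − a| > ε}` tends to `1`. -/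
theorem weak_law_outer_probability_tendsto_one
    {Ω₁ : Type*} [MeasurableSpace Ω₁] (P₁ : Measure Ω₁) [IsProbabilityMeasure P₁]
    (P : Measure (ℕ → Ω₁)) [IsProbabilityMeasure P]
    (hP : IsProjectiveLimit P (fun J : Finset ℕ => Measure.pi (fun _ : J => P₁)))
    (Ψ Ψlow Ψup Ψabs : Ω₁ → ℝ)
    (hΨlow : IsMeasMinorant P₁ Ψ Ψlow)
    (hΨup : IsMeasMajorant P₁ Ψ Ψup)
    (hΨabs : IsMeasMajorant P₁ (fun x => |Ψ x|) Ψabs)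
    (hInt : Integrable Ψabs P₁)
    (a ε : ℝ) (hε : 0 < ε)
    (ha : a ∈ Set.Icc (∫ x, Ψlow x ∂P₁) (∫ x, Ψup x ∂P₁))
    (hnotsub : ¬ Set.Icc (∫ x, Ψlow x ∂P₁) (∫ x, Ψup x ∂P₁) ⊆ Set.Icc (a - ε) (a + ε)) :
    Tendsto (fun n : ℕ =>
        ⨅ (B : Set (ℕ → Ω₁)) (_ : MeasurableSet B ∧
          {ω : ℕ → Ω₁ | ε < |(∑ i ∈ Finset.range n, Ψ (ω i)) / n - a|} ⊆ B), P B)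
      atTop (𝓝 1) := by
  obtain rfl : P = Measure.infinitePi (fun _ => P₁) :=
    hP.unique (Measure.isProjectiveLimit_infinitePi (fun _ => P₁))
  have hiInf (s : Set (ℕ → Ω₁)) :
      ⨅ (B : Set (ℕ → Ω₁)) (_ : MeasurableSet B ∧ s ⊆ B), Measure.infinitePi (fun _ => P₁) B =
        Measure.infinitePi (fun _ => P₁) s := by
    rw [measure_eq_iInf s]
    exact iInf_congr fun B => by rw [and_comm, iInf_and]
  simp_rw [hiInf]
  have hcases : a + ε < ∫ x, Ψup x ∂P₁ ∨ ε - a < ∫ x, -Ψlow x ∂P₁ := by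
    rw [integral_neg]
    by_contra! hcon
    exact hnotsub (Set.Icc_subset_Icc (by linarith [hcon.2]) hcon.1)
  rcases hcases with hup | hlow
  · refine tendsto_of_tendsto_of_tendsto_of_le_of_le
      (hΨup.tendsto_infinitePi_lt_average (hΨup.integrable hΨabs.1 hΨabs.2.1 hInt) hup)
      tendsto_const_nhds (fun n => measure_mono fun ω hω => ?_) (fun n => prob_le_one)
    simp only [Set.mem_ofPred_eq] at hω ⊢
    exact lt_abs.2 (Or.inl (by linarith))
  · refine tendsto_of_tendsto_of_tendsto_of_le_of_le
      (hΨlow.neg.tendsto_infinitePi_lt_average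
        (hΨlow.neg.integrable hΨabs.1 (by simpa using hΨabs.2.1) hInt) hlow)
      tendsto_const_nhds (fun n => measure_mono fun ω hω => ?_) (fun n => prob_le_one)
    simp only [Set.mem_ofPred_eq, Finset.sum_neg_distrib, neg_div] at hω ⊢
    exact lt_abs.2 (Or.inr (by linarith))
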